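/- Suppose a double complex of complex vector spaces satisfies the d'd''-lemma at every (p,q) ∈ ℤ². Then for every k ∈ ℤ the natural map H^k → ⊕_{p+q=k} H_A^{p,q} (sending the class of α = Σ α_{p,q} ∈ ker d ∩ A^k to the family of Aeppli classes of its components α_{p,q}) is an isomorphism. Equivalently, for every k: ker d ∩ (Im d' + Im d'') ∩ A^k = Im d ∩ A^k and ker d'd'' ∩ A^k = (ker d + Im d' + Im d'') ∩ A^k. -/

import Mathlib

open Submodule

/-- A double complex of complex vector spaces, realized as an internally bigraded
module `W = ⊕_{p,q} A p q` together with global differentials `d'`, `d''` of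
bidegrees `(1,0)` and `(0,1)` satisfying `d'∘d' = 0`, `d''∘d'' = 0` and
`d'∘d'' + d''∘d' = 0`. -/
structure BiComplex (W : Type*) [AddCommGroup W] [Module ℂ W] where
  A : ℤ → ℤ → Submodule ℂ W
  d' : W →ₗ[ℂ] W
  d'' : W →ₗ[ℂ] W
  internal : DirectSum.IsInternal (fun pq : ℤ × ℤ => A pq.1 pq.2)
  map_d' : ∀ p q : ℤ, (A p q).map d' ≤ A (p + 1) q
  map_d'' : ∀ p q : ℤ, (A p q).map d'' ≤ A p (q + 1)
  d'_sq : d' ∘ₗ d' = 0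
  d''_sq : d'' ∘ₗ d'' = 0
  anticomm : d' ∘ₗ d'' + d'' ∘ₗ d' = 0

namespace BiComplex

variable {W : Type*} [AddCommGroup W] [Module ℂ W] (C : BiComplex W)

/-- `ker d' ∩ A^{p,q}` : the kernel of `d' : A^{p,q} → A^{p+1,q}`. -/
def kerd' (p q : ℤ) : Submodule ℂ W := LinearMap.ker C.d' ⊓ C.A p q

/-- `ker d'' ∩ A^{p,q}` : the kernel of `d'' : A^{p,q} → A^{p,q+1}`. -/
def kerd'' (p q : ℤ) : Submodule ℂ W := LinearMap.ker C.d'' ⊓ C.A p q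

/-- `Im d' ∩ A^{p,q} = d'(A^{p-1,q})`. -/
def imd' (p q : ℤ) : Submodule ℂ W := (C.A (p - 1) q).map C.d'

/-- `Im d'' ∩ A^{p,q} = d''(A^{p,q-1})`. -/
def imd'' (p q : ℤ) : Submodule ℂ W := (C.A p (q - 1)).map C.d''

/-- `Im d'd'' ∩ A^{p,q} = (d'∘d'')(A^{p-1,q-1})`. -/
def imd'd'' (p q : ℤ) : Submodule ℂ W := (C.A (p - 1) (q - 1)).map (C.d' ∘ₗ C.d'')

/-- `ker d'd'' ∩ A^{p,q}` : the kernel of `d'∘d'' : A^{p,q} → A^{p+1,q+1}`. -/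
def kerd'd'' (p q : ℤ) : Submodule ℂ W := LinearMap.ker (C.d' ∘ₗ C.d'') ⊓ C.A p q

/-- The `d'd''`-lemma at `(p,q)`:
`Im d' ∩ ker d'' ∩ A^{p,q} = ker d' ∩ Im d'' ∩ A^{p,q} = Im d'd'' ∩ A^{p,q}`. -/
def DDLemmaAt (p q : ℤ) : Prop :=
  C.imd' p q ⊓ C.kerd'' p q = C.imd'd'' p q ∧ C.kerd' p q ⊓ C.imd'' p q = C.imd'd'' p q

/-- The total-degree piece `A^k = ⊕_{p+q=k} A^{p,q}`. -/
def Atot (k : ℤ) : Submodule ℂ W := ⨆ p : ℤ, C.A p (k - p)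

/-- The total differential `d = d' + d''`. -/
def dtot : W →ₗ[ℂ] W := C.d' + C.d''

/-- `ker d ∩ A^k` : the kernel of `d : A^k → A^{k+1}`. -/
def kerdTot (k : ℤ) : Submodule ℂ W := LinearMap.ker C.dtot ⊓ C.Atot k

/-- `Im d ∩ A^k = d(A^{k-1})`. -/
def imdTot (k : ℤ) : Submodule ℂ W := (C.Atot (k - 1)).map C.dtot

/-- `ker d' ∩ ker d'' ∩ A^k = ⊕_{p+q=k} (ker d' ∩ ker d'' ∩ A^{p,q})`. -/
def kerd'kerd''Tot (k : ℤ) : Submodule ℂ W :=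
  ⨆ p : ℤ, (C.kerd' p (k - p) ⊓ C.kerd'' p (k - p))

/-- `Im d'd'' ∩ A^k = ⊕_{p+q=k} (Im d'd'' ∩ A^{p,q})`. -/
def imd'd''Tot (k : ℤ) : Submodule ℂ W := ⨆ p : ℤ, C.imd'd'' p (k - p)

/-- `ker d'd'' ∩ A^k = ⊕_{p+q=k} (ker d'd'' ∩ A^{p,q})`. -/
def kerd'd''Tot (k : ℤ) : Submodule ℂ W := ⨆ p : ℤ, C.kerd'd'' p (k - p)

/-- `Im d' ∩ A^k = ⊕_{p+q=k} (Im d' ∩ A^{p,q})`. -/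
def imd'Tot (k : ℤ) : Submodule ℂ W := ⨆ p : ℤ, C.imd' p (k - p)

/-- `Im d'' ∩ A^k = ⊕_{p+q=k} (Im d'' ∩ A^{p,q})`. -/
def imd''Tot (k : ℤ) : Submodule ℂ W := ⨆ p : ℤ, C.imd'' p (k - p)

/-- The double complex is totally bounded: `A^{p,q} = 0` for `|p| > N` or `|q| > N`. -/
def TotallyBounded : Prop :=
  ∃ N : ℕ, ∀ p q : ℤ, ((N : ℤ) < |p| ∨ (N : ℤ) < |q|) → C.A p q = ⊥

end BiComplex

/-- The quotient vector space `S / T` of a submodule `S` by (the trace of) a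
submodule `T ≤ S`. -/
abbrev quotSub {W : Type*} [AddCommGroup W] [Module ℂ W] (S T : Submodule ℂ W) :=
  S ⧸ (Submodule.comap S.subtype T)

/-- A linear map sending the members of a family of submodules into independent submodules has
homogeneous kernel. -/
theorem LinearMap.mem_iSup_ker_inf_of_iSupIndep {R M N ι : Type*} [Ring R]
    [AddCommGroup M] [Module R M] [AddCommGroup N] [Module R N]
    {B : ι → Submodule R M} {D : ι → Submodule R N} (hD : iSupIndep D) (T : M →ₗ[R] N)
    (hT : ∀ i, (B i).map T ≤ D i) {x : M} (hx : x ∈ ⨆ i, B i) (hTx : T x = 0) :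
    x ∈ ⨆ i, (LinearMap.ker T ⊓ B i) := by
  obtain ⟨f, hf, rfl⟩ := (Submodule.mem_iSup_iff_exists_finsupp _ _).mp hx
  rw [Finsupp.sum, map_sum] at hTx
  refine Submodule.sum_mem _ fun i hi => Submodule.mem_iSup_of_mem i ⟨?_, hf i⟩
  exact (iSupIndep_iff_finsetSum_eq_zero_imp_eq_zero D).mp hD f.support (fun j => T (f j))
    (fun j _ => hT j (Submodule.mem_map_of_mem (hf j))) hTx i hi

namespace BiComplex

variable {W : Type*} [AddCommGroup W] [Module ℂ W] (C : BiComplex W)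

theorem d'_d' (x : W) : C.d' (C.d' x) = 0 := LinearMap.congr_fun C.d'_sq x

theorem d''_d'' (x : W) : C.d'' (C.d'' x) = 0 := LinearMap.congr_fun C.d''_sq x

theorem d''_d' (x : W) : C.d'' (C.d' x) = -C.d' (C.d'' x) :=
  eq_neg_of_add_eq_zero_right (LinearMap.congr_fun C.anticomm x)

theorem dtot_apply (x : W) : C.dtot x = C.d' x + C.d'' x := rfl

variable {C}

theorem d'_mem {p q : ℤ} {x : W} (hx : x ∈ C.A p q) : C.d' x ∈ C.A (p + 1) q :=
  C.map_d' p q (Submodule.mem_map_of_mem hx)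

theorem d''_mem {p q : ℤ} {x : W} (hx : x ∈ C.A p q) : C.d'' x ∈ C.A p (q + 1) :=
  C.map_d'' p q (Submodule.mem_map_of_mem hx)

theorem mem_Atot {k p q : ℤ} (hk : p + q = k) {x : W} (hx : x ∈ C.A p q) : x ∈ C.Atot k := by
  obtain rfl : q = k - p := by omega
  exact Submodule.mem_iSup_of_mem p hx

theorem mem_kerd'd''Tot {k : ℤ} {x : W} (hx : x ∈ C.Atot k) (h0 : C.d' (C.d'' x) = 0) :
    x ∈ C.kerd'd''Tot k := by
  have inj : Function.Injective fun p : ℤ => (p + 1, k - p + 1) := fun a b hab => by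
    simpa using congrArg Prod.fst hab
  refine LinearMap.mem_iSup_ker_inf_of_iSupIndep (C.internal.submodule_iSupIndep.comp inj)
    (C.d' ∘ₗ C.d'') ?_ hx h0
  rintro p _ ⟨y, hy, rfl⟩
  exact d'_mem (d''_mem hy)

theorem d'_mem_imd'Tot {k : ℤ} {x : W} (hx : x ∈ C.Atot (k - 1)) : C.d' x ∈ C.imd'Tot k := by
  suffices C.Atot (k - 1) ≤ (C.imd'Tot k).comap C.d' from this hx
  refine iSup_le fun p y hy => Submodule.mem_iSup_of_mem (p + 1) ⟨y, ?_, rfl⟩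
  rw [SetLike.mem_coe]
  convert hy using 2 <;> ring

theorem d''_mem_imd''Tot {k : ℤ} {x : W} (hx : x ∈ C.Atot (k - 1)) : C.d'' x ∈ C.imd''Tot k := by
  suffices C.Atot (k - 1) ≤ (C.imd''Tot k).comap C.d'' from this hx
  refine iSup_le fun p y hy => Submodule.mem_iSup_of_mem p ⟨y, ?_, rfl⟩
  rw [SetLike.mem_coe]
  convert hy using 2
  ring

theorem imd'Tot_eq_map (C : BiComplex W) (k : ℤ) :
    C.imd'Tot k = (C.Atot (k - 1)).map C.d' := by
  refine le_antisymm (iSup_le fun p => ?_) ?_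
  · exact Submodule.map_mono fun x hx => mem_Atot (by ring) hx
  · rintro _ ⟨x, hx, rfl⟩
    exact d'_mem_imd'Tot hx

theorem imd''Tot_eq_map (C : BiComplex W) (k : ℤ) :
    C.imd''Tot k = (C.Atot (k - 1)).map C.d'' := by
  refine le_antisymm (iSup_le fun p => ?_) ?_
  · exact Submodule.map_mono fun x hx => mem_Atot (by ring) hx
  · rintro _ ⟨x, hx, rfl⟩
    exact d''_mem_imd''Tot hx

theorem imd'Tot_le_Atot (C : BiComplex W) (k : ℤ) : C.imd'Tot k ≤ C.Atot k := by
  refine iSup_le fun p => ?_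
  rintro _ ⟨x, hx, rfl⟩
  exact mem_Atot (by ring) (d'_mem hx)

theorem imd''Tot_le_Atot (C : BiComplex W) (k : ℤ) : C.imd''Tot k ≤ C.Atot k := by
  refine iSup_le fun p => ?_
  rintro _ ⟨x, hx, rfl⟩
  exact mem_Atot (by ring) (d''_mem hx)

theorem DDLemmaAt.exists_d'_eq {p q : ℤ} (h : C.DDLemmaAt (p + 1) q) {x : W}
    (hx : x ∈ C.A p q) (h0 : C.d' (C.d'' x) = 0) :
    ∃ y ∈ C.A p (q - 1), C.d' (C.d'' y) = C.d' x := by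
  have hmem : C.d' x ∈ C.imd'd'' (p + 1) q := by
    rw [← h.1]
    refine ⟨⟨x, by simpa using hx, rfl⟩, ?_, d'_mem hx⟩
    simp [d''_d', h0]
  obtain ⟨y, hy, hyx⟩ := hmem
  exact ⟨y, by simpa using hy, hyx⟩

theorem DDLemmaAt.exists_d''_eq {p q : ℤ} (h : C.DDLemmaAt p (q + 1)) {x : W}
    (hx : x ∈ C.A p q) (h0 : C.d' (C.d'' x) = 0) :
    ∃ y ∈ C.A (p - 1) q, C.d' (C.d'' y) = C.d'' x := by
  have hmem : C.d'' x ∈ C.imd'd'' p (q + 1) := by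
    rw [← h.2]
    exact ⟨⟨h0, d''_mem hx⟩, x, by simpa using hx, rfl⟩
  obtain ⟨y, hy, hyx⟩ := hmem
  exact ⟨y, by simpa using hy, hyx⟩

/-- Under the `d'd''`-lemma, `d''` maps `ker d'd''` into the image of `d`. -/
theorem d''_mem_imdTot (h : ∀ p q : ℤ, C.DDLemmaAt p q) {k : ℤ} {x : W}
    (hx : x ∈ C.kerd'd''Tot (k - 1)) : C.d'' x ∈ C.imdTot k := by
  suffices C.kerd'd''Tot (k - 1) ≤ (C.imdTot k).comap C.d'' from this hx
  refine iSup_le fun p y hy => ?_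
  obtain ⟨z, hz, hzy⟩ := (h _ _).exists_d''_eq hy.2 hy.1
  refine ⟨-C.d' z, neg_mem (mem_Atot (by ring) (d'_mem hz)), ?_⟩
  simp [dtot_apply, d'_d', d''_d', hzy]

theorem kerdTot_inf_eq (h : ∀ p q : ℤ, C.DDLemmaAt p q) (k : ℤ) :
    C.kerdTot k ⊓ (C.imd'Tot k ⊔ C.imd''Tot k) = C.imdTot k := by
  apply le_antisymm
  · rintro x ⟨⟨hx, -⟩, hx'⟩
    rw [imd'Tot_eq_map, imd''Tot_eq_map] at hx'
    obtain ⟨_, ⟨b, hb, rfl⟩, _, ⟨c, hc, rfl⟩, rfl⟩ := Submodule.mem_sup.mp hx'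
    have h0 : C.d' (C.d'' (c - b)) = 0 := by
      simpa [dtot_apply, d'_d', d''_d'', d''_d', sub_eq_add_neg, add_comm] using hx
    have hd := d''_mem_imdTot h (mem_kerd'd''Tot (sub_mem hc hb) h0)
    convert add_mem hd (Submodule.mem_map_of_mem (f := C.dtot) hb) using 1
    rw [dtot_apply, map_sub]
    abel
  · rintro _ ⟨x, hx, rfl⟩
    have h' := d'_mem_imd'Tot hx
    have h'' := d''_mem_imd''Tot hx
    refine ⟨⟨?_, add_mem (C.imd'Tot_le_Atot k h') (C.imd''Tot_le_Atot k h'')⟩,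
      Submodule.add_mem_sup h' h''⟩
    simp [dtot_apply, d'_d', d''_d'', d''_d']

theorem kerd'd''Tot_eq (h : ∀ p q : ℤ, C.DDLemmaAt p q) (k : ℤ) :
    C.kerd'd''Tot k = C.kerdTot k ⊔ C.imd'Tot k ⊔ C.imd''Tot k := by
  apply le_antisymm
  · refine iSup_le fun p x hx => ?_
    obtain ⟨b, hb, hbx⟩ := (h _ _).exists_d''_eq hx.2 hx.1
    obtain ⟨c, hc, hcx⟩ := (h _ _).exists_d'_eq hx.2 hx.1
    have hb' := d'_mem_imd'Tot (mem_Atot (k := k - 1) (by ring) hb)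
    have hc' := d''_mem_imd''Tot (mem_Atot (k := k - 1) (by ring) hc)
    have hker : x + C.d' b - C.d'' c ∈ C.kerdTot k := by
      refine ⟨?_, sub_mem (add_mem (mem_Atot (by ring) hx.2) (C.imd'Tot_le_Atot k hb'))
        (C.imd''Tot_le_Atot k hc')⟩
      simp [dtot_apply, d'_d', d''_d'', d''_d', hbx, hcx]
    convert Submodule.add_mem_sup (Submodule.add_mem_sup hker (neg_mem hb')) hc' using 1
    abel
  · refine sup_le (sup_le ?_ fun x hx => ?_) fun x hx => ?_
    · rintro x ⟨hx, hxk⟩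
      refine mem_kerd'd''Tot hxk ?_
      have hd := congrArg C.d' (LinearMap.mem_ker.mp hx)
      simpa [dtot_apply, d'_d'] using hd
    · refine mem_kerd'd''Tot (C.imd'Tot_le_Atot k hx) ?_
      rw [imd'Tot_eq_map] at hx
      obtain ⟨y, -, rfl⟩ := hx
      simp [d''_d', d'_d']
    · refine mem_kerd'd''Tot (C.imd''Tot_le_Atot k hx) ?_
      rw [imd''Tot_eq_map] at hx
      obtain ⟨y, -, rfl⟩ := hx
      simp [d''_d'']

end BiComplex

/-- If the double complex satisfies the `d'd''`-lemma at every
`(p,q)`, then for every `k` the natural map `H^k → ⊕_{p+q=k} H_A^{p,q}` is an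
isomorphism; equivalently, for every `k`:
`ker d ∩ (Im d' + Im d'') ∩ A^k = Im d ∩ A^k` and
`ker d'd'' ∩ A^k = (ker d + Im d' + Im d'') ∩ A^k`. -/
theorem bicomplex_ddlemma_implies_deRham_eq_A
    {W : Type*} [AddCommGroup W] [Module ℂ W] (C : BiComplex W)
    (h : ∀ p q : ℤ, C.DDLemmaAt p q) :
    ∀ k : ℤ,
      C.kerdTot k ⊓ (C.imd'Tot k ⊔ C.imd''Tot k) = C.imdTot k ∧
      C.kerd'd''Tot k = C.kerdTot k ⊔ C.imd'Tot k ⊔ C.imd''Tot k :=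
  fun k => ⟨BiComplex.kerdTot_inf_eq h k, BiComplex.kerd'd''Tot_eq h k⟩
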